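/- Supersolution step for flux limiters: fix an integer K ≥ 1. For each i ∈ {1,…,K}, let H̃_i : ℝ → ℝ be convex and continuous with a unique global minimum point p_i^0, define H̃_i^-(p) = H̃_i(p) for p ≤ p_i^0 and H̃_i^-(p) = H̃_i(p_i^0) for p ≥ p_i^0, let A ≥ H̃_i(p_i^0) for all i, and let p_i^A ∈ [p_i^0, ∞) satisfy H̃_i(p_i^A) = A. Let b ∈ ℝ and q_1,…,q_K ∈ ℝ satisfy b + max(A, max_{1≤i≤K} H̃_i^-(q_i)) ≥ 0, and suppose −Σ_{i=1}^K q_i + Σ_{i=1}^K p_i^A ≤ 0. Then there exists i_0 ∈ {1,…,K} with b + H̃_{i_0}(q_{i_0}) ≥ 0. -/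

import Mathlib

/-- The decreasing truncation `H̃⁻` of a convex Hamiltonian `H̃` with minimum point `p⁰`:
`H̃⁻(p) = H̃(p)` for `p ≤ p⁰` and `H̃⁻(p) = H̃(p⁰)` for `p ≥ p⁰`. -/
noncomputable def Hminus (H : ℝ → ℝ) (p0 : ℝ) (p : ℝ) : ℝ :=
  if p ≤ p0 then H p else H p0

/-- A convex function on `ℝ` is monotone to the right of a global minimum point. -/
theorem ConvexOn.le_of_isMin_left {H : ℝ → ℝ} (hH : ConvexOn ℝ Set.univ H) {m x y : ℝ}
    (hm : ∀ p, H m ≤ H p) (hmx : m ≤ x) (hxy : x ≤ y) : H x ≤ H y :=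
  (hH.le_max_of_mem_Icc (Set.mem_univ m) (Set.mem_univ y) ⟨hmx, hxy⟩).trans
    (max_le (hm y) le_rfl)

theorem Hminus_le {H : ℝ → ℝ} {m : ℝ} (hm : ∀ p, H m ≤ H p) (p : ℝ) : Hminus H m p ≤ H p := by
  unfold Hminus
  split_ifs
  exacts [le_rfl, hm p]

/-- **Supersolution step for flux limiters.**
For each `i` let `H̃_i` be convex continuous with unique global minimum point `p_i⁰`,
let `A ≥ H̃_i(p_i⁰)` for all `i` and `p_i^A ∈ [p_i⁰, ∞)` with `H̃_i(p_i^A) = A`. If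
`b + max(A, max_i H̃_i⁻(q_i)) ≥ 0` and `−Σ_i q_i + Σ_i p_i^A ≤ 0`, then there is `i₀`
with `b + H̃_{i₀}(q_{i₀}) ≥ 0`. -/
theorem flux_limiter_supersolution_step
    (K : ℕ) (hK : 0 < K) (H : Fin K → ℝ → ℝ)
    (hconv : ∀ i, ConvexOn ℝ Set.univ (H i))
    (hcont : ∀ i, Continuous (H i))
    (p0 : Fin K → ℝ)
    (hmin : ∀ i p, H i (p0 i) ≤ H i p)
    (huniq : ∀ i p, H i p = H i (p0 i) → p = p0 i)
    (A : ℝ) (hA : ∀ i, H i (p0 i) ≤ A)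
    (pA : Fin K → ℝ) (hpA1 : ∀ i, p0 i ≤ pA i) (hpA2 : ∀ i, H i (pA i) = A)
    (b : ℝ) (q : Fin K → ℝ)
    (hbq : 0 ≤ b + max A
      (Finset.univ.sup' ⟨⟨0, hK⟩, Finset.mem_univ _⟩ fun i => Hminus (H i) (p0 i) (q i)))
    (hsum : -∑ i, q i + ∑ i, pA i ≤ 0) :
    ∃ i₀ : Fin K, 0 ≤ b + H i₀ (q i₀) := by
  have hne : (Finset.univ : Finset (Fin K)).Nonempty := ⟨⟨0, hK⟩, Finset.mem_univ _⟩
  rcases max_choice A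
    (Finset.univ.sup' hne fun i => Hminus (H i) (p0 i) (q i)) with h | h <;> rw [h] at hbq
  · obtain ⟨i, -, hi⟩ := Finset.exists_le_of_sum_le hne
      (show ∑ i, pA i ≤ ∑ i, q i by linarith)
    have hle := (hconv i).le_of_isMin_left (hmin i) (hpA1 i) hi
    rw [hpA2 i] at hle
    exact ⟨i, by linarith⟩
  · obtain ⟨i, -, hi⟩ := Finset.exists_mem_eq_sup' hne
      fun i => Hminus (H i) (p0 i) (q i)
    rw [hi] at hbq
    have hle := Hminus_le (hmin i) (q i)
    exact ⟨i, by linarith⟩
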